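/- arXiv:1904.08350 — 2 statements merged into one kernel-verified Lean document; each statement's English description precedes it below -/
import Mathlib

section
/- Let Q be a commutative Noetherian local ring and g = g_1,...,g_s a regular sequence in Q. If an ideal I ⊆ Q is both a weak complete intersection ideal (i.e., the minimal free resolution F of Q/I satisfies Im ∂_i ⊆ I·F_{i-1} for all i) and a g-weak complete intersection ideal (i.e., Im ∂_i ⊆ (g)·F_{i-1} for all i), then I is a complete intersection ideal generated by elements of (g). -/
namespace WCI

variable {Q : Type*} [CommRing Q]

/-- Exactness modulo `J` at spot `q+1`. -/
def Ex {c : ℕ → ℕ} (d : ∀ k, (Fin (c (k+1)) → Q) →ₗ[Q] (Fin (c k) → Q)) (J : Ideal Q) (q : ℕ) :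
    Prop :=
  ∀ v : Fin (c (q+1)) → Q, (∀ j, d q v j ∈ J) → ∃ w, ∀ j, (v - d (q+1) w) j ∈ J

lemma coord_mem {n : ℕ} {J : Ideal Q} {v : Fin n → Q}
    (h : v ∈ J • (⊤ : Submodule Q (Fin n → Q))) (j) : v j ∈ J := by
  induction h using Submodule.smul_induction_on' with
  | smul r hr n hn => simpa using J.mul_mem_right _ hr
  | add x hx y hy h1 h2 => exact J.add_mem h1 h2

lemma map_mem {n m : ℕ} (f : (Fin n → Q) →ₗ[Q] (Fin m → Q)) {I J : Ideal Q}
    (hf : ∀ v j, f v j ∈ I) {v : Fin n → Q} (hv : ∀ j, v j ∈ J) (j) : f v j ∈ J * I := by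
  rw [LinearMap.pi_apply_eq_sum_univ f v]
  simp only [Finset.sum_apply, Pi.smul_apply, smul_eq_mul]
  exact Ideal.sum_mem _ fun i _ => Ideal.mul_mem_mul (hv i) (hf _ _)

lemma map_mem' {n m : ℕ} (f : (Fin n → Q) →ₗ[Q] (Fin m → Q)) {J : Ideal Q}
    {v : Fin n → Q} (hv : ∀ j, v j ∈ J) (j) : f v j ∈ J := by
  have h := map_mem f (I := ⊤) (fun _ _ => Submodule.mem_top) hv j
  rwa [Ideal.mul_top] at h

section
variable {c : ℕ → ℕ} {d : ∀ k, (Fin (c (k+1)) → Q) →ₗ[Q] (Fin (c k) → Q)}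

lemma ex_step (hdd : ∀ k v, d k (d (k+1) v) = 0) {J : Ideal Q} {q : ℕ} (h0 : Ex d J q)
    (h1 : Ex d J (q+1)) {x : Q}
    (hx : ∀ a, x * a ∈ J → a ∈ J) : Ex d (J ⊔ Ideal.span {x}) (q+1) := by
  intro v hv
  have : ∀ j, ∃ u, d (q+1) v j - x * u ∈ J := by
    intro j
    obtain ⟨y, hy, z, hz, e⟩ := Submodule.mem_sup.1 (hv j)
    obtain ⟨u, rfl⟩ := Ideal.mem_span_singleton.1 hz
    exact ⟨u, by rw [← e]; simpa using hy⟩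
  choose u hu using this
  have hdu : ∀ j, d q u j ∈ J := by
    intro j
    apply hx
    have := map_mem' (d q) (v := d (q+1) v - x • u) (J := J) (by intro j; simpa using hu j) j
    rw [map_sub, hdd, map_smul] at this
    simpa using this
  obtain ⟨w, hw⟩ := h0 u hdu
  obtain ⟨w', hw'⟩ := h1 (v - x • w) (by
    intro j
    have := J.add_mem (hu j) (J.mul_mem_left x (hw j))
    rw [map_sub, map_smul]
    simp only [Pi.sub_apply, Pi.smul_apply, smul_eq_mul] at this ⊢
    convert this using 1
    ring)
  refine ⟨w', fun j => ?_⟩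
  have h3 : (v - d (q+1+1) w') j = (v - x • w - d (q+1+1) w') j + x * w j := by
    simp; ring
  rw [h3]
  exact Ideal.add_mem _ (Ideal.mem_sup_left (hw' j))
    (Ideal.mem_sup_right (Ideal.mul_mem_right _ _ (Ideal.mem_span_singleton_self x)))

lemma regular_quot (J : Ideal Q) (x : Q) :
    IsSMulRegular (Q ⧸ (J • ⊤ : Submodule Q Q)) x ↔ ∀ a, x * a ∈ J → a ∈ J := by
  rw [isSMulRegular_iff_right_eq_zero_of_smul]
  constructor
  · intro h a ha
    have := h (Submodule.Quotient.mk a) (by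
      rw [← Submodule.Quotient.mk_smul, Submodule.Quotient.mk_eq_zero]; simpa using ha)
    rw [Submodule.Quotient.mk_eq_zero] at this
    simpa using this
  · intro h m
    induction m using Submodule.Quotient.induction_on with
    | _ a =>
    rw [← Submodule.Quotient.mk_smul, Submodule.Quotient.mk_eq_zero, Submodule.Quotient.mk_eq_zero]
    simpa using h a

open RingTheory.Sequence

lemma weak_append (rs : List Q) (x : Q) : IsWeaklyRegular Q (rs ++ [x]) ↔
    IsWeaklyRegular Q rs ∧ ∀ a, x * a ∈ Ideal.ofList rs → a ∈ Ideal.ofList rs := by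
  rw [isWeaklyRegular_append_iff, isWeaklyRegular_singleton_iff, regular_quot]

lemma ex_list (hdd : ∀ k v, d k (d (k+1) v) = 0) (h0 : ∀ q, Ex d ⊥ q) (rs : List Q)
    (hrs : IsWeaklyRegular Q rs) : ∀ q, rs.length ≤ q → Ex d (Ideal.ofList rs) q := by
  induction rs using List.reverseRecOn with
  | nil => intro q _; simpa using h0 q
  | append_singleton rs x ih =>
    rw [weak_append] at hrs
    intro q hq
    simp only [List.length_append, List.length_singleton] at hq
    obtain ⟨q, rfl⟩ : ∃ q', q = q' + 1 := ⟨q - 1, by omega⟩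
    rw [Ideal.ofList_append, Ideal.ofList_singleton]
    exact ex_step hdd (ih hrs.1 q (by omega)) (ih hrs.1 _ (by omega)) hrs.2

lemma exists_lift {n : ℕ} {M N : Type*} [AddCommGroup M] [AddCommGroup N] [Module Q M]
    [Module Q N] (f : M →ₗ[Q] N) (φ : (Fin n → Q) →ₗ[Q] N) (h : ∀ v, φ v ∈ LinearMap.range f) :
    ∃ ψ : (Fin n → Q) →ₗ[Q] M, ∀ v, f (ψ v) = φ v := by
  obtain ⟨ψ, hψ⟩ := Module.projective_lifting_property f.rangeRestrict
    (φ.codRestrict (LinearMap.range f) h) f.surjective_rangeRestrict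
  refine ⟨ψ, fun v => ?_⟩
  have := congrArg Subtype.val (LinearMap.congr_fun hψ v)
  simpa using this

lemma homotopy (hex : ∀ k, LinearMap.ker (d k) = LinearMap.range (d (k+1))) {x : Q}
    (h0 : ∀ v, x • v ∈ LinearMap.range (d 0)) (k : ℕ) :
    ∃ h : (Fin (c k) → Q) →ₗ[Q] (Fin (c (k+1)) → Q), ∀ v, d k (h (d k v)) = x • d k v := by
  have next : ∀ k, ∀ h : (Fin (c k) → Q) →ₗ[Q] (Fin (c (k+1)) → Q),
    (∀ v, d k (h (d k v)) = x • d k v) → ∃ h' : (Fin (c (k+1)) → Q) →ₗ[Q] (Fin (c (k+2)) → Q),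
      ∀ v, d (k+1) (h' v) = x • v - h (d k v) := by
    intro k h hh
    obtain ⟨h', hh'⟩ := exists_lift (d (k+1)) (x • LinearMap.id - h ∘ₗ d k) (by
      intro v
      rw [← hex]
      simp [hh])
    exact ⟨h', fun v => by simpa using hh' v⟩
  induction k with
  | zero =>
    obtain ⟨h, hh⟩ := exists_lift (d 0) (x • LinearMap.id) (by simpa using h0)
    exact ⟨h, fun v => by simp [hh]⟩
  | succ k ih =>
    obtain ⟨h, hh⟩ := ih
    obtain ⟨h', hh'⟩ := next k h hh
    refine ⟨h', fun v => ?_⟩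
    have : d k (d (k+1) v) = 0 := by
      rw [← LinearMap.mem_ker, hex]; exact ⟨v, rfl⟩
    rw [hh', this]; simp

lemma homotopy' (hex : ∀ k, LinearMap.ker (d k) = LinearMap.range (d (k+1))) {x : Q}
    (h0 : ∀ v, x • v ∈ LinearMap.range (d 0)) (k : ℕ) :
    ∃ h : (Fin (c k) → Q) →ₗ[Q] (Fin (c (k+1)) → Q),
    ∃ h' : (Fin (c (k+1)) → Q) →ₗ[Q] (Fin (c (k+2)) → Q),
      ∀ v, d (k+1) (h' v) = x • v - h (d k v) := by
  obtain ⟨h, hh⟩ := homotopy hex h0 k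
  obtain ⟨h', hh'⟩ := exists_lift (d (k+1)) (x • LinearMap.id - h ∘ₗ d k) (by
    intro v
    rw [← hex]
    simp [hh])
  exact ⟨h, h', fun v => by simpa using hh' v⟩

variable [IsLocalRing Q]

def V (d : ∀ k, (Fin (c (k+1)) → Q) →ₗ[Q] (Fin (c k) → Q)) (I J : Ideal Q) (k : ℕ) : Prop :=
  ∃ v : Fin (c k) → Q, (∃ j, v j ∉ IsLocalRing.maximalIdeal Q) ∧
    ∀ x ∈ I, ∃ w, ∀ j, (d k w - x • v) j ∈ J

lemma V_step (hex : ∀ k, LinearMap.ker (d k) = LinearMap.range (d (k+1))) {I J : Ideal Q}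
    (hI : ∀ k v j, d k v j ∈ I) (h0 : ∀ x ∈ I, ∀ v, x • v ∈ LinearMap.range (d 0))
    {k : ℕ} (hV : V d I J k) {x : Q} (hx : x ∈ I)
    (hx' : x ∉ J ⊔ IsLocalRing.maximalIdeal Q * I) : V d I (J ⊔ Ideal.span {x}) (k+1) := by
  obtain ⟨v, ⟨j, hj⟩, hv⟩ := hV
  obtain ⟨w, hw⟩ := hv x hx
  refine ⟨w, ?_, ?_⟩
  · by_contra! hc
    apply hx'
    have h1 := map_mem (d k) (hI k) hc j
    have h2 := hw j
    have hu : IsUnit (v j) := by simpa using hj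
    rw [← Ideal.mul_unit_mem_iff_mem _ hu]
    have : x * v j = - (d k w - x • v) j + d k w j := by simp
    rw [this]
    exact Ideal.add_mem _ (Ideal.mem_sup_left (J.neg_mem h2)) (Ideal.mem_sup_right h1)
  · intro y hy
    obtain ⟨h, h', hh⟩ := homotopy' hex (h0 y hy) k
    refine ⟨h' w, fun i => ?_⟩
    rw [hh]
    have : (y • w - h (d k w) - y • w) = - h (d k w) := by abel
    rw [this]
    refine Ideal.neg_mem_iff _ |>.2 (map_mem' h (fun i => ?_) i)
    have : d k w i = (d k w - x • v) i + x * v i := by simp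
    rw [this]
    exact Ideal.add_mem _ (Ideal.mem_sup_left (hw i))
      (Ideal.mem_sup_right (Ideal.mul_mem_right _ _ (Ideal.mem_span_singleton_self x)))

lemma exists_nzd [IsNoetherianRing Q] {I J : Ideal Q} (hIJ : ¬ I ≤ J)
    (hy : ∀ y, (∀ x ∈ I, y * x ∈ J) → y ∈ J) :
    ∃ x ∈ I, x ∉ J ⊔ IsLocalRing.maximalIdeal Q * I ∧ ∀ a, x * a ∈ J → a ∈ J := by
  classical
  set N := J ⊔ IsLocalRing.maximalIdeal Q * I with hN
  by_contra! hcon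
  have hfin := associatedPrimes.finite Q (Q ⧸ J)
  have key := (I.subset_union_prime_finite (s := insert N (associatedPrimes Q (Q ⧸ J)))
    (hfin.insert N) (f := id) N N (fun i hi h1 _ => by
      rcases hi with rfl | hi
      · exact absurd rfl h1
      · exact hi.isPrime)).1 (by
      intro x hx
      by_cases hxN : x ∈ N
      · simp [hxN]
      · obtain ⟨a, ha, ha'⟩ := hcon x hx hxN
        have : x ∈ ⋃ p ∈ associatedPrimes Q (Q ⧸ J), (p : Set Q) := by
          rw [biUnion_associatedPrimes_eq_zero_divisors]
          refine ⟨Ideal.Quotient.mk J a, ?_, ?_⟩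
          · rwa [Ne, Ideal.Quotient.eq_zero_iff_mem]
          · rw [← Ideal.Quotient.mk_eq_mk, ← Submodule.Quotient.mk_smul,
              Submodule.Quotient.mk_eq_zero]
            exact ha
        simp only [Set.mem_iUnion] at this ⊢
        obtain ⟨p, hp, h⟩ := this
        exact ⟨p, Or.inr hp, h⟩)
  obtain ⟨p, rfl | hp, hle⟩ := key
  · apply hIJ
    refine Submodule.le_of_le_smul_of_le_jacobson_bot (IsNoetherian.noetherian I)
      (IsLocalRing.maximalIdeal_le_jacobson ⊥) hle
  · rw [AssociatedPrimes.mem_iff, isAssociatedPrime_iff] at hp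
    obtain ⟨hpr, z, rfl⟩ := hp
    obtain ⟨y, rfl⟩ := Ideal.Quotient.mk_surjective z
    have hyJ : y ∈ J := by
      apply hy
      intro x hx
      have := hle hx
      simp only [id, Submodule.mem_colon_singleton, Submodule.mem_bot] at this
      rw [← Ideal.Quotient.mk_eq_mk, ← Submodule.Quotient.mk_smul,
              Submodule.Quotient.mk_eq_zero] at this
      rw [mul_comm]; exact this
    apply hpr.ne_top
    rw [Ideal.Quotient.eq_zero_iff_mem.2 hyJ]
    simp

theorem main [IsNoetherianRing Q] (hex : ∀ k, LinearMap.ker (d k) = LinearMap.range (d (k+1)))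
    {I : Ideal Q} (hIm : I ≠ ⊤)
    (hI : ∀ k v j, d k v j ∈ I) (h0 : ∀ x ∈ I, ∀ v, x • v ∈ LinearMap.range (d 0))
    (hc : c 0 ≠ 0) (gs : List Q) (hgs : IsWeaklyRegular Q gs) (hgt : Ideal.ofList gs ≠ ⊤)
    (hg : ∀ k v j, d k v j ∈ Ideal.ofList gs) :
    ∃ rs : List Q, IsWeaklyRegular Q rs ∧ I = Ideal.ofList rs := by
  have hdd : ∀ k v, d k (d (k+1) v) = 0 := fun k v => by
    rw [← LinearMap.mem_ker, hex]; exact ⟨v, rfl⟩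
  have hE0 : ∀ q, Ex d ⊥ q := by
    intro q v hv
    have : v ∈ LinearMap.ker (d q) := by
      rw [LinearMap.mem_ker]; ext j; simpa using hv j
    rw [hex] at this
    obtain ⟨w, rfl⟩ := this
    exact ⟨w, by simp⟩
  -- finite length
  have hlen : ∀ q, gs.length ≤ q → c (q+1) = 0 := by
    intro q hq
    by_contra hne
    apply hgt
    have hE := ex_list hdd hE0 gs hgs q hq
    let j0 : Fin (c (q+1)) := ⟨0, Nat.pos_of_ne_zero hne⟩
    obtain ⟨w, hw⟩ := hE (Pi.single j0 1) (hg _ _)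
    rw [Ideal.eq_top_iff_one]
    have := Ideal.add_mem _ (hw j0) (hg _ w j0)
    simpa using this
  by_contra! hcon
  have hgood : ∀ k, ∃ rs : List Q, rs.length = k ∧ IsWeaklyRegular Q rs ∧ Ideal.ofList rs ≤ I ∧
      V d I (Ideal.ofList rs) k := by
    intro k
    induction k with
    | zero =>
      refine ⟨[], rfl, .nil _ _, by simp, ?_⟩
      let j0 : Fin (c 0) := ⟨0, Nat.pos_of_ne_zero hc⟩
      refine ⟨Pi.single j0 1, ⟨j0, by simp⟩, fun x hx => ?_⟩
      obtain ⟨w, hw⟩ := h0 x hx (Pi.single j0 1)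
      exact ⟨w, by simp [hw]⟩
    | succ k ih =>
      obtain ⟨rs, hl, hreg, hle, hV⟩ := ih
      have hnle : ¬ I ≤ Ideal.ofList rs := fun h => hcon rs hreg (le_antisymm h hle)
      -- the top degree
      have hex_p : ∃ q, k ≤ q ∧ c (q+1) ≠ 0 ∧ c (q+2) = 0 := by
        have hk1 : c (k+1) ≠ 0 := by
          obtain ⟨x, hx, hx'⟩ : ∃ x ∈ I, x ∉ Ideal.ofList rs ⊔ IsLocalRing.maximalIdeal Q * I := by
            by_contra! hcc
            exact hnle (Submodule.le_of_le_smul_of_le_jacobson_bot (IsNoetherian.noetherian I)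
              (IsLocalRing.maximalIdeal_le_jacobson ⊥) hcc)
          obtain ⟨v, ⟨j, -⟩, -⟩ := V_step hex hI h0 hV hx hx'
          intro h
          exact (Fin.cast h j).elim0
        by_contra! hcc
        have : ∀ q, k ≤ q → c (q+1) ≠ 0 := by
          intro q hq
          induction q, hq using Nat.le_induction with
          | base => exact hk1
          | succ q hq ih => exact hcc q hq ih
        exact this (max k gs.length) (le_max_left _ _) (hlen _ (le_max_right _ _))
      obtain ⟨q, hkq, hq1, hq2⟩ := hex_p
      obtain ⟨x, hx, hx', hxr⟩ := exists_nzd (I := I) (J := Ideal.ofList rs) hnle (by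
        intro y hy
        let j0 : Fin (c (q+1)) := ⟨0, Nat.pos_of_ne_zero hq1⟩
        obtain ⟨w, hw⟩ := ex_list hdd hE0 rs hreg q (by omega) (y • Pi.single j0 1) (by
          intro j
          rw [map_smul]
          exact hy _ (hI _ _ _))
        have hw0 : w = 0 := by
          ext j
          exact (Fin.cast hq2 j).elim0
        have := hw j0
        simpa [hw0] using this)
      refine ⟨rs ++ [x], by simp [hl], (weak_append _ _).2 ⟨hreg, hxr⟩, ?_, ?_⟩
      · rw [Ideal.ofList_append, Ideal.ofList_singleton]
        exact sup_le hle ((Ideal.span_singleton_le_iff_mem _).2 hx)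
      · rw [Ideal.ofList_append, Ideal.ofList_singleton]
        exact V_step hex hI h0 hV hx hx'
  obtain ⟨rs, -, -, -, v, ⟨j, -⟩, -⟩ := hgood (gs.length + 1)
  exact (Fin.cast (hlen _ le_rfl) j).elim0

end

/-- Ranks with `F₀ = Q`. -/
def rk (b : ℕ → ℕ) : ℕ → ℕ
  | 0 => 1
  | k+1 => b (k+1)

/-- The differentials with `F₀ = Q`. -/
def dd (b : ℕ → ℕ) (d1 : (Fin (b 1) → Q) →ₗ[Q] Q)
    (d : ∀ i : ℕ, (Fin (b (i + 2)) → Q) →ₗ[Q] (Fin (b (i + 1)) → Q)) :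
    ∀ k, (Fin (rk b (k+1)) → Q) →ₗ[Q] (Fin (rk b k) → Q)
  | 0 => LinearMap.pi (fun _ : Fin 1 => d1)
  | k+1 => d k

lemma ofList_ofFn {s : ℕ} (g : Fin s → Q) :
    Ideal.ofList (List.ofFn g) = Ideal.span (Set.range g) := by
  unfold Ideal.ofList
  congr 1
  ext x
  simp [List.mem_ofFn]

end WCI


/-- If an ideal `I` of a Noetherian local ring `Q` is simultaneously a weak complete
intersection ideal (the differentials of the minimal free resolution of `Q/I` land in
`I·F`) and a `g`-weak complete intersection ideal (they land in `(g)·F`), then `I` is a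
complete intersection ideal generated by a regular sequence of elements of `(g)`. -/
theorem wci_and_gwci_implies_complete_intersection
    {Q : Type*} [CommRing Q] [IsNoetherianRing Q] [IsLocalRing Q]
    {s : ℕ} (g : Fin s → Q)
    (hreg : RingTheory.Sequence.IsRegular Q (List.ofFn g))
    (I : Ideal Q)
    -- a minimal free resolution of `Q/I`, with `F₀ = Q`:
    (b : ℕ → ℕ)
    (d1 : (Fin (b 1) → Q) →ₗ[Q] Q)
    (hd1 : LinearMap.range d1 = I)
    (d : ∀ i : ℕ, (Fin (b (i + 2)) → Q) →ₗ[Q] (Fin (b (i + 1)) → Q))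
    (hex1 : LinearMap.ker d1 = LinearMap.range (d 0))
    (hex : ∀ i, LinearMap.ker (d i) = LinearMap.range (d (i + 1)))
    -- minimality:
    (hmin1 : LinearMap.range d1 ≤ (IsLocalRing.maximalIdeal Q) • ⊤)
    (hmin : ∀ i, LinearMap.range (d i) ≤ (IsLocalRing.maximalIdeal Q) • ⊤)
    -- `I` is a weak complete intersection ideal:
    (hwci1 : LinearMap.range d1 ≤ I • ⊤)
    (hwci : ∀ i, LinearMap.range (d i) ≤ I • ⊤)
    -- `I` is a `g`-weak complete intersection ideal:
    (hgw1 : LinearMap.range d1 ≤ (Ideal.span (Set.range g)) • ⊤)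
    (hgw : ∀ i, LinearMap.range (d i) ≤ (Ideal.span (Set.range g)) • ⊤) :
    ∃ (t : ℕ) (f : Fin t → Q),
      (∀ j, f j ∈ Ideal.span (Set.range g)) ∧
      RingTheory.Sequence.IsRegular Q (List.ofFn f) ∧
      I = Ideal.span (Set.range f) := by
  have hIm : I ≠ ⊤ := by
    intro h
    rw [hd1, h] at hmin1
    exact (IsLocalRing.maximalIdeal.isMaximal Q).ne_top (top_le_iff.1 (by simpa using hmin1))
  have hIg : I ≤ Ideal.span (Set.range g) := by
    rw [← hd1]; simpa using hgw1
  have hgt : Ideal.ofList (List.ofFn g) ≠ ⊤ := by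
    intro h
    apply hreg.top_ne_smul
    rw [h]; simp
  obtain ⟨rs, hrs, hI⟩ := WCI.main (c := WCI.rk b) (d := WCI.dd b d1 d) (I := I) (by
      rintro (_ | k)
      · refine Eq.trans ?_ hex1
        ext v
        simp only [LinearMap.mem_ker]
        constructor
        · intro h; exact congrFun h (0 : Fin 1)
        · intro h; exact funext fun _ => h
      · exact hex k) hIm (by
      rintro (_ | k) v j
      · rw [← hd1]; exact ⟨v, rfl⟩
      · exact WCI.coord_mem (hwci k ⟨v, rfl⟩) j) (by
      intro x hx v
      have hx2 : x * v (0 : Fin 1) ∈ I := I.mul_mem_right _ hx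
      rw [← hd1] at hx2
      obtain ⟨w, hw⟩ := hx2
      refine ⟨w, funext fun j => ?_⟩
      have : j = (0 : Fin 1) := Subsingleton.elim (α := Fin 1) _ _
      subst this
      exact hw) (by simp [WCI.rk]) (List.ofFn g) hreg.toIsWeaklyRegular hgt (by
      rw [WCI.ofList_ofFn]
      rintro (_ | k) v j
      · apply hIg; rw [← hd1]; exact ⟨v, rfl⟩
      · exact WCI.coord_mem (hgw k ⟨v, rfl⟩) j)
  have hspan : I = Ideal.span (Set.range rs.get) := by
    rw [← WCI.ofList_ofFn, List.ofFn_get]; exact hI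
  refine ⟨rs.length, rs.get, fun j => hIg ?_, ?_, hspan⟩
  · rw [hspan]; exact Ideal.subset_span ⟨j, rfl⟩
  · rw [List.ofFn_get]
    refine ⟨hrs, ?_⟩
    rw [← hI]
    intro h
    apply hIm
    rw [h]; simp
end

section
/- With notation as in the definition of ∂/∂g_j via a fixed splitting σ, the map ∂/∂g_j satisfies the modified product rule: for q = Σ_N σ(q̄_N)g^N and r = Σ_M σ(r̄_M)g^M in Q, ∂/∂g_j(qr) = ∂/∂g_j(q)·r + ∂/∂g_j(r)·q + Σ_{M,N} (∂/∂g_j(σ(q̄_N)σ(r̄_M))) g^{M+N}. -/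
/-- The monomial `g^N = g₁^{N₁} ⋯ g_s^{N_s}`. -/
noncomputable def gMonomial {Q : Type*} [CommRing Q] {s : ℕ} (g : Fin s → Q)
    (N : Fin s → ℕ) : Q :=
  ∏ i, g i ^ N i

/-- The finite set of multi-indices `N ∈ ℕ^s` with `|N| < m`. -/
noncomputable def multiIdx (s m : ℕ) : Finset (Fin s → ℕ) :=
  (Fintype.piFinset fun _ : Fin s => Finset.range m).filter fun N => ∑ i, N i < m

/-- `c` is the family of coefficients of the `g`-adic expansion of `q` via the
splitting `σ`: the partial sums `∑_{|N|<m} σ(c N) g^N` converge `(g)`-adically to `q`. -/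
def IsGAdicExpansion {Q : Type*} [CommRing Q] {s : ℕ} (g : Fin s → Q)
    (σ : Q ⧸ Ideal.span (Set.range g) → Q) (q : Q)
    (c : (Fin s → ℕ) → Q ⧸ Ideal.span (Set.range g)) : Prop :=
  ∀ m : ℕ, q - ∑ N ∈ multiIdx s m, σ (c N) * gMonomial g N ∈
    (Ideal.span (Set.range g)) ^ m

/-- The `N`-th term `N_j · σ(c_N) · g^{N - e_j}` of the termwise partial derivative
`∂/∂g_j` of an element with `g`-adic coefficients `c`.  (When `N_j = 0` the factor
`N_j = 0` kills the term, so the truncated exponent is harmless.) -/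
noncomputable def gDerivTerm {Q : Type*} [CommRing Q] {s : ℕ} (g : Fin s → Q)
    (σ : Q ⧸ Ideal.span (Set.range g) → Q)
    (c : (Fin s → ℕ) → Q ⧸ Ideal.span (Set.range g)) (j : Fin s)
    (N : Fin s → ℕ) : Q :=
  (N j : Q) * σ (c N) * ∏ i, g i ^ (N i - if i = j then 1 else 0)

/-- `D` is the family of partial derivatives `∂/∂g_j` determined (termwise on `g`-adic
expansions, given by `coef` and the splitting `σ`) in the `(g)`-adic topology. -/
def IsPartialDerivFamily {Q : Type*} [CommRing Q] {s : ℕ} (g : Fin s → Q)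
    (σ : Q ⧸ Ideal.span (Set.range g) → Q)
    (coef : Q → (Fin s → ℕ) → Q ⧸ Ideal.span (Set.range g))
    (D : Fin s → Q → Q) : Prop :=
  ∀ (j : Fin s) (q : Q) (m : ℕ),
    D j q - ∑ N ∈ multiIdx s (m + 1), gDerivTerm g σ (coef q) j N ∈
      (Ideal.span (Set.range g)) ^ m

open MvPolynomial

lemma prodPow_mem {Q : Type*} [CommRing Q] {s : ℕ} (g : Fin s → Q) (d : Fin s → ℕ) :
    ∏ i, g i ^ d i ∈ (Ideal.span (Set.range g)) ^ (∑ i, d i) := by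
  rw [← Finset.prod_pow_eq_pow_sum]
  exact Ideal.prod_mem_prod fun i _ =>
    Ideal.pow_mem_pow (Ideal.subset_span (Set.mem_range_self i)) _

lemma eval_mem_of_coeff {Q : Type*} [CommRing Q] {s : ℕ} (g : Fin s → Q) (n : ℕ)
    (F : MvPolynomial (Fin s) Q) (hF : F.IsHomogeneous n)
    (h : ∀ d, F.coeff d ∈ Ideal.span (Set.range g)) :
    eval g F ∈ (Ideal.span (Set.range g)) ^ (n + 1) := by
  rw [eval_eq', pow_succ']
  refine Ideal.sum_mem _ fun d hd => Ideal.mul_mem_mul (h d) ?_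
  have h1 : d.degree = n := by
    by_contra hne
    exact (mem_support_iff.1 hd) (hF.coeff_eq_zero hne)
  have h2 := prodPow_mem g d
  rwa [← Finsupp.degree_eq_sum, h1] at h2

lemma exists_hom_coeff {Q : Type*} [CommRing Q] {s : ℕ} (g : Fin s → Q) (n : ℕ) (y : Q)
    (hy : y ∈ (Ideal.span (Set.range g)) ^ (n + 1)) :
    ∃ F : MvPolynomial (Fin s) Q, F.IsHomogeneous n ∧
      (∀ d, F.coeff d ∈ Ideal.span (Set.range g)) ∧ eval g F = y := by
  rw [pow_succ'] at hy
  refine Submodule.mul_induction_on hy (fun a ha b hb => ?_) (fun x y hx hy => ?_)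
  · obtain ⟨G, hG, rfl⟩ := (Ideal.mem_span_pow_iff_exists_isHomogeneous g b).1 hb
    refine ⟨C a * G, hG.C_mul a, fun d => ?_, by simp⟩
    rw [coeff_C_mul]
    exact Ideal.mul_mem_right _ _ ha
  · obtain ⟨F, hF, hFc, rfl⟩ := hx
    obtain ⟨G, hG, hGc, rfl⟩ := hy
    exact ⟨F + G, hF.add hG, fun d => by rw [coeff_add]; exact Ideal.add_mem _ (hFc d) (hGc d),
      by simp⟩

/-- quasi-regularity -/
def QReg {Q : Type*} [CommRing Q] {s : ℕ} (g : Fin s → Q) : Prop :=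
  ∀ (n : ℕ) (F : MvPolynomial (Fin s) Q), F.IsHomogeneous n →
    eval g F ∈ (Ideal.span (Set.range g)) ^ (n + 1) →
    ∀ d, F.coeff d ∈ Ideal.span (Set.range g)

lemma nzd_pow {Q : Type*} [CommRing Q] {s : ℕ} (g : Fin s → Q) (hq : QReg g) (a : Q)
    (ha : ∀ x, a * x ∈ Ideal.span (Set.range g) → x ∈ Ideal.span (Set.range g)) (i : ℕ) :
    ∀ x, a * x ∈ Ideal.span (Set.range g) ^ i → x ∈ Ideal.span (Set.range g) ^ i := by
  induction i with
  | zero => simp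
  | succ i ih =>
    intro x hx
    have hx' := ih x (Ideal.pow_le_pow_right (Nat.le_succ i) hx)
    obtain ⟨G, hG, rfl⟩ := (Ideal.mem_span_pow_iff_exists_isHomogeneous g x).1 hx'
    refine eval_mem_of_coeff g i G hG fun d => ha _ ?_
    rw [← coeff_C_mul]
    exact hq i _ (hG.C_mul a) (by simpa using hx) d

lemma hom_decomp {Q : Type*} [CommRing Q] {s : ℕ} (n : ℕ)
    (F : MvPolynomial (Fin (s + 1)) Q) (hF : F.IsHomogeneous (n + 1)) :
    ∃ (G : MvPolynomial (Fin s) Q) (H : MvPolynomial (Fin (s + 1)) Q),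
      G.IsHomogeneous (n + 1) ∧ H.IsHomogeneous n ∧
      F = rename Fin.castSucc G + X (Fin.last s) * H := by
  have h1 := modMonomial_add_divMonomial_single F (Fin.last s)
  set R := F.modMonomial (Finsupp.single (Fin.last s) 1) with hR
  set H := F.divMonomial (Finsupp.single (Fin.last s) 1) with hH
  have hH' : H.IsHomogeneous n := by
    intro d hd
    rw [hH, coeff_divMonomial] at hd
    have := hF hd
    simp only [map_add, Finsupp.weight_single] at this
    simp at this
    omega
  have hR' : R.IsHomogeneous (n + 1) := by
    rw [← add_sub_cancel_right R (X (Fin.last s) * H), h1]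
    refine hF.sub ?_
    have := (isHomogeneous_X Q (Fin.last s)).mul hH'
    rwa [Nat.add_comm 1 n] at this
  have hv : (R.vars : Set (Fin (s + 1))) ⊆ Set.range Fin.castSucc := by
    intro i hi
    obtain ⟨d, hd, hdi⟩ := mem_vars_iff_mem_support i |>.1 hi
    rcases Fin.eq_castSucc_or_eq_last i with ⟨j, rfl⟩ | rfl
    · simp
    · exfalso
      refine (mem_support_iff.1 hd) (coeff_modMonomial_of_le _ ?_)
      rw [Finsupp.single_le_iff]
      exact Nat.one_le_iff_ne_zero.2 (Finsupp.mem_support_iff.1 hdi)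
  obtain ⟨G, hG⟩ := exists_rename_eq_of_vars_subset_range R Fin.castSucc
    (Fin.castSucc_injective s) hv
  refine ⟨G, H, ?_, hH', ?_⟩
  · rw [← IsHomogeneous.rename_isHomogeneous_iff (Fin.castSucc_injective s), hG]; exact hR'
  · rw [hG, h1]

lemma coeff_rename_mem {Q : Type*} [CommRing Q] {s t : ℕ} (f : Fin s → Fin t)
    (hf : Function.Injective f) (I : Ideal Q)
    (G : MvPolynomial (Fin s) Q) (h : ∀ d, G.coeff d ∈ I) (d) : (rename f G).coeff d ∈ I := by
  by_cases hd : ∃ u : Fin s →₀ ℕ, u.mapDomain f = d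
  · obtain ⟨u, rfl⟩ := hd
    rw [coeff_rename_mapDomain f hf]; exact h u
  · rw [coeff_rename_eq_zero _ _ _ (fun u hu => (hd ⟨u, hu⟩).elim)]; exact I.zero_mem

lemma coeff_X_mul_mem {Q : Type*} [CommRing Q] {s : ℕ} (i : Fin s) (I : Ideal Q)
    (G : MvPolynomial (Fin s) Q) (h : ∀ d, G.coeff d ∈ I) (d) : (X i * G).coeff d ∈ I := by
  classical
  rw [coeff_X_mul']
  split_ifs
  · exact h _
  · exact I.zero_mem

lemma qreg_step {Q : Type*} [CommRing Q] {s : ℕ} (g : Fin (s + 1) → Q)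
    (hq : QReg (fun i => g (Fin.castSucc i)))
    (ha : ∀ x, g (Fin.last s) * x ∈ Ideal.span (Set.range fun i => g (Fin.castSucc i)) →
      x ∈ Ideal.span (Set.range fun i => g (Fin.castSucc i))) : QReg g := by
  set g' : Fin s → Q := fun i => g (Fin.castSucc i) with hg'
  have hJI : Ideal.span (Set.range g') ≤ Ideal.span (Set.range g) :=
    Ideal.span_mono (by rintro _ ⟨i, rfl⟩; exact ⟨_, rfl⟩)
  intro n
  induction n with
  | zero =>
    intro F hF hev d
    have h0 : F = C (F.coeff 0) := 
      totalDegree_eq_zero_iff_eq_C.1 ((totalDegree_zero_iff_isHomogeneous _).2 hF)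
    rw [h0] at hev ⊢
    classical
    rw [coeff_C]
    split_ifs
    · simpa using hev
    · exact Ideal.zero_mem _
  | succ n ih =>
    intro F hF hev d
    obtain ⟨F', hF', hFc, hFe⟩ := exists_hom_coeff g (n + 1) _ hev
    -- reduce to the vanishing case
    obtain ⟨G, H, hG, hH, hE⟩ := hom_decomp n (F - F') (hF.sub hF')
    have h0 : eval g' G + g (Fin.last s) * eval g H = 0 := by
      have := congrArg (eval g) hE
      rw [map_sub, hFe, sub_self] at this
      rw [this]
      simp [eval_rename, hg', Function.comp_def]
    have h1 : g (Fin.last s) * eval g H ∈ Ideal.span (Set.range g') ^ (n + 1) := by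
      rw [eq_neg_of_add_eq_zero_right h0]
      exact neg_mem ((Ideal.mem_span_pow_iff_exists_isHomogeneous g' _).2 ⟨G, hG, rfl⟩)
    have h2 := nzd_pow g' hq _ ha _ _ h1
    have h3 := ih H hH (Ideal.pow_right_mono hJI _ h2)
    obtain ⟨h, hh, hhe⟩ := (Ideal.mem_span_pow_iff_exists_isHomogeneous g' _).1 h2
    have h4 := hq (n + 1) (G + C (g (Fin.last s)) * h) (hG.add (hh.C_mul _)) (by
      simp only [map_add, map_mul, eval_C, hhe, h0]; exact Ideal.zero_mem _)
    have h5 : ∀ d, G.coeff d ∈ Ideal.span (Set.range g) := fun d => by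
      have := hJI (h4 d)
      rw [coeff_add, coeff_C_mul] at this
      exact (Ideal.add_mem_iff_left _ (Ideal.mul_mem_right _ _
        (Ideal.subset_span (Set.mem_range_self _)))).1 this
    have h6 : F = F' + (rename Fin.castSucc G + X (Fin.last s) * H) := by rw [← hE]; ring
    rw [h6, coeff_add, coeff_add]
    exact Ideal.add_mem _ (hFc d) (Ideal.add_mem _
      (coeff_rename_mem _ (Fin.castSucc_injective s) _ _ h5 d) (coeff_X_mul_mem _ _ _ h3 d))

lemma ofList_ofFn {Q : Type*} [CommRing Q] {s : ℕ} (g : Fin s → Q) :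
    Ideal.ofList (List.ofFn g) = Ideal.span (Set.range g) := by
  unfold Ideal.ofList
  congr 1
  ext x
  simp [List.mem_ofFn]

lemma qreg_of_weaklyRegular {Q : Type*} [CommRing Q] {s : ℕ} (g : Fin s → Q)
    (h : RingTheory.Sequence.IsWeaklyRegular Q (List.ofFn g)) : QReg g := by
  induction s with
  | zero =>
    intro n F hF hev d
    have hI : Ideal.span (Set.range g) = ⊥ := by simp
    rw [hI] at hev ⊢
    have hd : d = 0 := Subsingleton.elim _ _
    rw [eq_C_of_isEmpty F] at hev
    simp at hev
    subst hd
    simpa using hev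
  | succ s ih =>
    rw [List.ofFn_succ', List.concat_eq_append,
      RingTheory.Sequence.isWeaklyRegular_append_iff] at h
    refine qreg_step g (ih _ h.1) fun x hx => ?_
    have h2 := h.2
    rw [RingTheory.Sequence.isWeaklyRegular_singleton_iff, ofList_ofFn] at h2
    rw [isSMulRegular_quotient_iff_mem_of_smul_mem] at h2
    have := h2 x
    simpa using this (by simpa using hx)

lemma eval_mem_of_low {Q : Type*} [CommRing Q] {s : ℕ} (g : Fin s → Q) (m : ℕ)
    (F : MvPolynomial (Fin s) Q) (h : ∀ d, d.degree < m → F.coeff d = 0) :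
    eval g F ∈ (Ideal.span (Set.range g)) ^ m := by
  rw [eval_eq']
  refine Ideal.sum_mem _ fun d hd => Ideal.mul_mem_left _ _ ?_
  have h1 : m ≤ d.degree := by
    by_contra hne
    exact (mem_support_iff.1 hd) (h d (not_le.1 hne))
  have h2 := prodPow_mem g d
  rw [← Finsupp.degree_eq_sum] at h2
  exact Ideal.pow_le_pow_right h1 h2

lemma low_coeff {Q : Type*} [CommRing Q] {s : ℕ} (g : Fin s → Q) (hq : QReg g)
    (S : AddSubgroup Q) (hS : ∀ x ∈ S, x ∈ Ideal.span (Set.range g) → x = 0)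
    (m : ℕ) (F : MvPolynomial (Fin s) Q) (hF : ∀ d, F.coeff d ∈ S)
    (h : eval g F ∈ (Ideal.span (Set.range g)) ^ m) (n : ℕ) :
    ∀ d, d.degree = n → n < m → F.coeff d = 0 := by
  induction n using Nat.strong_induction_on with
  | _ n ih =>
    intro d hd hn
    have h1 : eval g (F - homogeneousComponent n F) ∈ (Ideal.span (Set.range g)) ^ (n + 1) := by
      refine eval_mem_of_low g _ _ fun e he => ?_
      rw [coeff_sub, coeff_homogeneousComponent]
      split_ifs with h2
      · simp
      · rw [ih e.degree (by omega) e rfl (by omega), sub_zero]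
    have h3 : eval g (homogeneousComponent n F) ∈ (Ideal.span (Set.range g)) ^ (n + 1) := by
      rw [map_sub] at h1
      have := Ideal.sub_mem _ (Ideal.pow_le_pow_right (show n + 1 ≤ m from hn) h) h1
      simpa using this
    have h4 := hq n _ (homogeneousComponent_isHomogeneous n F) h3 d
    rw [coeff_homogeneousComponent, if_pos hd] at h4
    exact hS _ (hF d) h4

lemma eval_pderiv_mem {Q : Type*} [CommRing Q] {s : ℕ} (g : Fin s → Q) (m : ℕ) (j : Fin s)
    (F : MvPolynomial (Fin s) Q) (h : ∀ d, d.degree < m + 1 → F.coeff d = 0) :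
    eval g (pderiv j F) ∈ (Ideal.span (Set.range g)) ^ m := by
  rw [F.as_sum, map_sum, map_sum]
  refine Ideal.sum_mem _ fun d hd => ?_
  have h1 : m + 1 ≤ d.degree := by
    by_contra hne
    exact (mem_support_iff.1 hd) (h d (not_le.1 hne))
  rw [pderiv_monomial]
  refine eval_mem_of_low g m _ fun e he => ?_
  classical
  rw [coeff_monomial]
  split_ifs with h2
  · by_cases h0 : d j = 0
    · simp [h0]
    · exfalso
      have h3 : d = e + Finsupp.single j 1 := by
        rw [← h2, tsub_add_cancel_of_le]
        rw [Finsupp.single_le_iff]; omega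
      rw [h3, map_add, Finsupp.degree_single] at h1
      omega
  · rfl

/-- expansion polynomial -/
noncomputable def expPoly {Q : Type*} [CommRing Q] {s : ℕ} (c : (Fin s → ℕ) → Q) (m : ℕ) :
    MvPolynomial (Fin s) Q :=
  ∑ N ∈ multiIdx s m, monomial (Finsupp.equivFunOnFinite.symm N) (c N)

lemma eval_monomial_g {Q : Type*} [CommRing Q] {s : ℕ} (g : Fin s → Q) (N : Fin s → ℕ) (a : Q) :
    eval g (monomial (Finsupp.equivFunOnFinite.symm N) a) = a * gMonomial g N := by
  rw [eval_monomial, Finsupp.prod_fintype _ _ (by simp)]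
  rfl

lemma eval_pderiv_monomial_g {Q : Type*} [CommRing Q] {s : ℕ} (g : Fin s → Q) (N : Fin s → ℕ)
    (a : Q) (j : Fin s) :
    eval g (pderiv j (monomial (Finsupp.equivFunOnFinite.symm N) a)) =
      (N j : Q) * a * ∏ i, g i ^ (N i - if i = j then 1 else 0) := by
  rw [pderiv_monomial, eval_monomial, Finsupp.prod_fintype _ _ (by simp)]
  simp only [Finsupp.tsub_apply, Finsupp.equivFunOnFinite_symm_apply_apply, Finsupp.single_apply,
    eq_comm (a := j)]
  rw [mul_comm a]

lemma coeff_monomial_mul_mem {Q : Type*} [CommRing Q] {s : ℕ} (S : AddSubgroup Q)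
    (u : Fin s →₀ ℕ) (F : MvPolynomial (Fin s) Q) (hF : ∀ d, F.coeff d ∈ S) (d) :
    (F * monomial u 1).coeff d ∈ S := by
  classical
  rw [coeff_mul_monomial']
  split_ifs
  · rw [mul_one]; exact hF _
  · exact S.zero_mem

lemma coeff_sum_mem {Q ι : Type*} [CommRing Q] {s : ℕ} (S : AddSubgroup Q)
    (t : Finset ι) (F : ι → MvPolynomial (Fin s) Q) (hF : ∀ i ∈ t, ∀ d, (F i).coeff d ∈ S) (d) :
    (∑ i ∈ t, F i).coeff d ∈ S := by
  rw [coeff_sum]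
  exact S.sum_mem fun i hi => hF i hi d

lemma coeff_expPoly_mem {Q : Type*} [CommRing Q] {s : ℕ} (S : AddSubgroup Q)
    (c : (Fin s → ℕ) → Q) (hc : ∀ N, c N ∈ S) (m : ℕ) (d) : (expPoly c m).coeff d ∈ S := by
  classical
  refine coeff_sum_mem S _ _ (fun N _ d => ?_) d
  rw [coeff_monomial]
  split_ifs
  · exact hc N
  · exact S.zero_mem

/-- The modified product rule for `∂/∂g_j`:
`∂/∂g_j(qr) = ∂/∂g_j(q)·r + ∂/∂g_j(r)·q + ∑_{M,N} ∂/∂g_j(σ(q̄_N)σ(r̄_M)) g^{M+N}`,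
where the (in general infinite) sum on the right is interpreted `(g)`-adically. -/
theorem partialDeriv_product_rule
    {k : Type*} [Field k] [CharZero k]
    {Q : Type*} [CommRing Q] [IsNoetherianRing Q] [Algebra k Q]
    {s : ℕ} (g : Fin s → Q)
    (hreg : RingTheory.Sequence.IsRegular Q (List.ofFn g))
    (hcomplete : IsAdicComplete (Ideal.span (Set.range g)) Q)
    (σ : (Q ⧸ Ideal.span (Set.range g)) →ₗ[k] Q)
    (hσ : ∀ x, Ideal.Quotient.mk (Ideal.span (Set.range g)) (σ x) = x)
    (coef : Q → (Fin s → ℕ) → Q ⧸ Ideal.span (Set.range g))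
    (hcoef : ∀ q, IsGAdicExpansion g (⇑σ) q (coef q))
    (D : Fin s → Q → Q)
    (hD : IsPartialDerivFamily g (⇑σ) coef D)
    (q r : Q) (j : Fin s) :
    ∀ m : ℕ,
      D j (q * r) - (D j q * r + D j r * q +
        ∑ P ∈ ((Fintype.piFinset fun _ : Fin s => Finset.range m) ×ˢ
            (Fintype.piFinset fun _ : Fin s => Finset.range m)).filter
            (fun P : (Fin s → ℕ) × (Fin s → ℕ) => (∑ i, P.1 i) + (∑ i, P.2 i) < m),
          D j (σ (coef q P.1) * σ (coef r P.2)) * gMonomial g (P.1 + P.2)) ∈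
        (Ideal.span (Set.range g)) ^ m := by
  intro m
  have hq := qreg_of_weaklyRegular g hreg.toIsWeaklyRegular
  let S : AddSubgroup Q := (LinearMap.range σ).toAddSubgroup
  have hSσ : ∀ x, σ x ∈ S := fun x => ⟨x, rfl⟩
  have hS : ∀ x ∈ S, x ∈ Ideal.span (Set.range g) → x = 0 := by
    rintro _ ⟨y, rfl⟩ hy
    have h1 := hσ y
    rw [Ideal.Quotient.eq_zero_iff_mem.2 hy] at h1
    rw [← h1, map_zero]
  -- expansions
  let E : Q → MvPolynomial (Fin s) Q := fun x => expPoly (fun N => σ (coef x N)) (m + 1)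
  have hES : ∀ x d, (E x).coeff d ∈ S := fun x d => coeff_expPoly_mem S _ (fun N => hSσ _) _ d
  have hE1 : ∀ x, x - eval g (E x) ∈ Ideal.span (Set.range g) ^ (m + 1) := fun x => by
    have := hcoef x (m + 1)
    simpa only [E, expPoly, map_sum, eval_monomial_g] using this
  have hE2 : ∀ x, D j x - eval g (pderiv j (E x)) ∈ Ideal.span (Set.range g) ^ m := fun x => by
    have := hD j x m
    simpa only [E, expPoly, map_sum, eval_pderiv_monomial_g, gDerivTerm] using this
  have key : ∀ x (F : MvPolynomial (Fin s) Q), (∀ d, F.coeff d ∈ S) →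
      x - eval g F ∈ Ideal.span (Set.range g) ^ (m + 1) → D j x - eval g (pderiv j F) ∈ Ideal.span (Set.range g) ^ m := by
    intro x F hF hx
    have h1 : eval g (E x - F) ∈ Ideal.span (Set.range g) ^ (m + 1) := by
      rw [map_sub]
      have := Ideal.sub_mem _ hx (hE1 x)
      convert this using 1; ring
    have h2 := eval_pderiv_mem g m j (E x - F) fun d hd =>
      low_coeff g hq S hS (m + 1) _ (fun d => by
        rw [coeff_sub]; exact S.sub_mem (hES x d) (hF d)) h1 _ d rfl hd
    have := Ideal.add_mem _ (hE2 x) h2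
    rw [map_sub, map_sub] at this
    convert this using 1; ring
  let A := multiIdx s (m + 1) ×ˢ multiIdx s (m + 1)
  let e : (Fin s → ℕ) → (Fin s →₀ ℕ) := fun N => Finsupp.equivFunOnFinite.symm N
  let p : (Fin s → ℕ) × (Fin s → ℕ) → Q := fun P => σ (coef q P.1) * σ (coef r P.2)
  let X' : (Fin s → ℕ) × (Fin s → ℕ) → MvPolynomial (Fin s) Q :=
    fun P => monomial (e (P.1 + P.2)) 1
  let T : MvPolynomial (Fin s) Q := ∑ P ∈ A, E (p P) * X' P
  have hXe : ∀ P, eval g (X' P) = gMonomial g (P.1 + P.2) := fun P => by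
    simp only [X', e, eval_monomial_g, one_mul]
  have hprod : E q * E r = ∑ P ∈ A, C (p P) * X' P := by
    simp only [E, expPoly, A, Finset.sum_mul_sum, Finset.sum_product]
    refine Finset.sum_congr rfl fun N _ => Finset.sum_congr rfl fun M _ => ?_
    rw [monomial_mul, C_mul_monomial, mul_one]
    congr 1
    refine congrArg _ (Finsupp.ext fun i => ?_)
    simp [e]
  have hTS : ∀ d, T.coeff d ∈ S := coeff_sum_mem S _ _ fun P _ =>
    coeff_monomial_mul_mem S _ _ (hES _)
  have hT : q * r - eval g T ∈ Ideal.span (Set.range g) ^ (m + 1) := by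
    have h1 : q * r - eval g (E q * E r) ∈ Ideal.span (Set.range g) ^ (m + 1) := by
      have := Ideal.add_mem _ (Ideal.mul_mem_right r _ (hE1 q))
        (Ideal.mul_mem_left _ (eval g (E q)) (hE1 r))
      rw [map_mul]
      convert this using 1; ring
    have h2 : eval g (E q * E r) - eval g T ∈ Ideal.span (Set.range g) ^ (m + 1) := by
      rw [hprod]
      simp only [T, map_sum, map_mul, eval_C, ← Finset.sum_sub_distrib, ← sub_mul]
      exact Ideal.sum_mem _ fun P _ => Ideal.mul_mem_right _ _ (hE1 _)
    have := Ideal.add_mem _ h1 h2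
    convert this using 1; ring
  have h1 := key _ T hTS hT
  have h2 : eval g (pderiv j T) - (∑ P ∈ A, D j (p P) * gMonomial g (P.1 + P.2) +
      eval g (pderiv j (E q * E r))) ∈ Ideal.span (Set.range g) ^ m := by
    rw [hprod]
    simp only [T, map_sum, Derivation.leibniz, smul_eq_mul, map_add, map_mul, pderiv_C, mul_zero,
      add_zero, eval_C, ← Finset.sum_add_distrib, ← Finset.sum_sub_distrib, hXe]
    refine Ideal.sum_mem _ fun P _ => ?_
    have h3 := Ideal.mul_mem_right (gMonomial g (P.1 + P.2)) _ (hE2 (p P))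
    have h4 := Ideal.mul_mem_right (eval g (pderiv j (X' P))) _
      (Ideal.pow_le_pow_right (Nat.le_succ m) (hE1 (p P)))
    have := neg_mem (Ideal.add_mem _ h3 h4)
    convert this using 1; simp; ring
  have h3 : eval g (pderiv j (E q * E r)) - (D j q * r + D j r * q) ∈ Ideal.span (Set.range g) ^ m := by
    simp only [Derivation.leibniz, smul_eq_mul, map_add, map_mul]
    have l : ∀ x, x - eval g (E x) ∈ Ideal.span (Set.range g) ^ m := fun x =>
      Ideal.pow_le_pow_right (Nat.le_succ m) (hE1 x)
    have a1 := Ideal.mul_mem_right (eval g (E r)) _ (hE2 q)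
    have a2 := Ideal.mul_mem_left _ (D j q) (l r)
    have a3 := Ideal.mul_mem_right (eval g (E q)) _ (hE2 r)
    have a4 := Ideal.mul_mem_left _ (D j r) (l q)
    have := neg_mem (Ideal.add_mem _ (Ideal.add_mem _ a1 a2) (Ideal.add_mem _ a3 a4))
    convert this using 1; ring
  set B := ((Fintype.piFinset fun _ : Fin s => Finset.range m) ×ˢ
            (Fintype.piFinset fun _ : Fin s => Finset.range m)).filter
            (fun P : (Fin s → ℕ) × (Fin s → ℕ) => (∑ i, P.1 i) + (∑ i, P.2 i) < m) with hB
  have hBA : B ⊆ A := by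
    intro P hP
    simp only [hB, A, multiIdx, Finset.mem_filter, Finset.mem_product, Fintype.mem_piFinset,
      Finset.mem_range] at hP ⊢
    obtain ⟨⟨b1, b2⟩, b3⟩ := hP
    exact ⟨⟨fun i => (b1 i).trans (Nat.lt_succ_self m), by omega⟩,
      ⟨fun i => (b2 i).trans (Nat.lt_succ_self m), by omega⟩⟩
  have h4 : ∑ P ∈ A, D j (p P) * gMonomial g (P.1 + P.2) -
      ∑ P ∈ B, D j (p P) * gMonomial g (P.1 + P.2) ∈ Ideal.span (Set.range g) ^ m := by
    classical
    rw [← Finset.sum_sdiff hBA, add_sub_cancel_right]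
    refine Ideal.sum_mem _ fun P hP => Ideal.mul_mem_left _ _ ?_
    have hPB := (Finset.mem_sdiff.1 hP).2
    have hm : m ≤ ∑ i, (P.1 + P.2) i := by
      simp only [Pi.add_apply, Finset.sum_add_distrib]
      by_contra hlt
      apply hPB
      simp only [hB, Finset.mem_filter, Finset.mem_product, Fintype.mem_piFinset,
        Finset.mem_range]
      have c1 := fun i => Finset.single_le_sum (f := P.1) (fun i _ => Nat.zero_le _)
        (Finset.mem_univ i)
      have c2 := fun i => Finset.single_le_sum (f := P.2) (fun i _ => Nat.zero_le _)
        (Finset.mem_univ i)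
      exact ⟨⟨fun i => by have := c1 i; omega, fun i => by have := c2 i; omega⟩, by omega⟩
    exact Ideal.pow_le_pow_right hm (prodPow_mem g (P.1 + P.2))
  have := Ideal.add_mem _ (Ideal.add_mem _ h1 h2) (Ideal.add_mem _ h3 h4)
  convert this using 1
  ring
end
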